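/- With high probability, the following holds for the random double digraph G = G_{n,ᾱ}: for every vertex a and every stage m < height(a,G), if S_{G,a,m+1} is defined via ι = 1 (i.e., some R₁-edge leads from S_{G,a,m} to a vertex outside S_{G,a,0} ∪ ⋯ ∪ S_{G,a,m}), then |S_{G,a,m+1}| ≤ |S_{G,a,m}| · n^{-α₁/2} + (log₂ n)²; in particular the new level is essentially smaller than the previous one when the previous one is large. -/

import Mathlib

open MeasureTheory Finset

/-- The Bernoulli measure on `Bool` giving `true` probability `p` (for `p ∈ [0,1]`). -/
noncomputable def bern (p : ℝ) : Measure Bool :=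
  ENNReal.ofReal p • Measure.dirac true + ENNReal.ofReal (1 - p) • Measure.dirac false

instance (p : ℝ) : IsFiniteMeasure (bern p) := by
  constructor
  simp only [bern, Measure.add_apply, Measure.smul_apply, smul_eq_mul]
  exact ENNReal.add_lt_top.mpr
    ⟨ENNReal.mul_lt_top ENNReal.ofReal_lt_top (measure_lt_top _ _),
     ENNReal.mul_lt_top ENNReal.ofReal_lt_top (measure_lt_top _ _)⟩

/-- Sample space for the random double digraph `G_{n,ᾱ}`: for each ordered pair of
vertices, a coin for `R₁` and a coin for `R₂`. -/
abbrev Omega (n : ℕ) : Type := ((Fin n × Fin n) → Bool) × ((Fin n × Fin n) → Bool)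

/-- The law of `G_{n,ᾱ}`: all coins independent, the `R₁`-coin of each pair has success
probability `n^{-(1+α₁)}` and the `R₂`-coin has success probability `n^{-(1-α₂)}`. -/
noncomputable def digraphMeasure (α₁ α₂ : ℝ) (n : ℕ) : Measure (Omega n) :=
  (Measure.pi fun _ : Fin n × Fin n => bern ((n : ℝ) ^ (-(1 + α₁)))).prod
    (Measure.pi fun _ : Fin n × Fin n => bern ((n : ℝ) ^ (-(1 - α₂))))

/-- The (irreflexive) relation `R₁` of the sampled double digraph. -/
def Rone {n : ℕ} (ω : Omega n) (a b : Fin n) : Bool :=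
  if a = b then false else ω.1 (a, b)

/-- The (irreflexive) relation `R₂` of the sampled double digraph. -/
def Rtwo {n : ℕ} (ω : Omega n) (a b : Fin n) : Bool :=
  if a = b then false else ω.2 (a, b)

/-- `(levelAux R1 R2 a k).1 = S_{G,a,k}` and `(levelAux R1 R2 a k).2 = S_{G,a,0} ∪ ⋯ ∪ S_{G,a,k}`:
`S_0 = {a}`; given `S_0,…,S_k`, if some `R₁`-edge goes from `S_k` to a vertex outside
`S_0 ∪ ⋯ ∪ S_k` then `S_{k+1}` is the set of endpoints of such `R₁`-edges; otherwise, if some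
`R₂`-edge does, `S_{k+1}` is the set of endpoints of such `R₂`-edges; otherwise `S_{k+1} = ∅`
(the process has stopped). -/
def levelAux {n : ℕ} (R1 R2 : Fin n → Fin n → Bool) (a : Fin n) :
    ℕ → Finset (Fin n) × Finset (Fin n)
  | 0 => ({a}, {a})
  | k + 1 =>
    let p := levelAux R1 R2 a k
    let N1 := Finset.univ.filter fun b => b ∉ p.2 ∧ ∃ a' ∈ p.1, R1 a' b = true
    let N2 := Finset.univ.filter fun b => b ∉ p.2 ∧ ∃ a' ∈ p.1, R2 a' b = true
    let S := if N1.Nonempty then N1 else N2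
    (S, p.2 ∪ S)

/-- The level set `S_{G,a,k}`. -/
def level {n : ℕ} (R1 R2 : Fin n → Fin n → Bool) (a : Fin n) (k : ℕ) : Finset (Fin n) :=
  (levelAux R1 R2 a k).1

/-- The union `S_{G,a,0} ∪ ⋯ ∪ S_{G,a,k}`. -/
def levelUnion {n : ℕ} (R1 R2 : Fin n → Fin n → Bool) (a : Fin n) (k : ℕ) : Finset (Fin n) :=
  (levelAux R1 R2 a k).2

/-- `height(a,G)`: the first stage `k` at which the process stops, i.e. at which neither an
`R₁`-edge nor an `R₂`-edge leaves `S_k` towards the complement of `S_0 ∪ ⋯ ∪ S_k`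
(equivalently, the first `k` with `S_{k+1} = ∅`). -/
noncomputable def heightAt {n : ℕ} (R1 R2 : Fin n → Fin n → Bool) (a : Fin n) : ℕ :=
  sInf {k | level R1 R2 a (k + 1) = ∅}

/-- `height(G) = max {height(a,G) : a ∈ [n]}`. -/
noncomputable def heightG {n : ℕ} (R1 R2 : Fin n → Fin n → Bool) : ℕ :=
  Finset.univ.sup (fun a => heightAt R1 R2 a)

/-- The level `S_{k+1}` avoids `S_0 ∪ ⋯ ∪ S_k`. -/
lemma disjoint_levelAux_succ {n : ℕ} (R1 R2 : Fin n → Fin n → Bool) (a : Fin n) (k : ℕ) :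
    Disjoint (levelAux R1 R2 a k).2 (levelAux R1 R2 a (k + 1)).1 := by
  rw [Finset.disjoint_left]
  intro x hx hx'
  simp only [levelAux] at hx'
  split_ifs at hx' <;> simp_all

/-- The first `k + 1` levels only depend on the `R₁`-edges leaving `S_0 ∪ ⋯ ∪ S_k`. -/
lemma levelAux_succ_congr {n : ℕ} {R1 R1' : Fin n → Fin n → Bool} (R2 : Fin n → Fin n → Bool)
    (a : Fin n) (k : ℕ) (h : ∀ x ∈ (levelAux R1 R2 a k).2, ∀ y, R1 x y = R1' x y) :
    levelAux R1 R2 a (k + 1) = levelAux R1' R2 a (k + 1) := by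
  have step : ∀ j, levelAux R1 R2 a j = levelAux R1' R2 a j →
      (∀ x ∈ (levelAux R1 R2 a j).1, ∀ y, R1 x y = R1' x y) →
      levelAux R1 R2 a (j + 1) = levelAux R1' R2 a (j + 1) := by
    intro j hj hR
    have hN : ∀ b, (∃ a' ∈ (levelAux R1 R2 a j).1, R1 a' b = true) ↔
        ∃ a' ∈ (levelAux R1 R2 a j).1, R1' a' b = true := fun b =>
      exists_congr fun a' => and_congr_right fun ha' => by rw [hR a' ha' b]
    simp only [levelAux, ← hj, hN]
  have hsub : ∀ j, (levelAux R1 R2 a j).1 ⊆ (levelAux R1 R2 a j).2 := by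
    intro j
    cases j with
    | zero => simp [levelAux]
    | succ j => exact Finset.subset_union_right
  induction k with
  | zero => exact step 0 rfl fun x hx => h x (hsub 0 hx)
  | succ k ih =>
    exact step (k + 1) (ih fun x hx => h x (Finset.mem_union_left _ hx))
      fun x hx => h x (hsub (k + 1) hx)

/-- The first `m` levels do not depend on the `R₁`-edges leaving `S_m`. -/
lemma levelAux_congr {n : ℕ} {R1 R1' : Fin n → Fin n → Bool} (R2 : Fin n → Fin n → Bool)
    (a : Fin n) (m : ℕ) (h : ∀ x ∉ (levelAux R1 R2 a m).1, ∀ y, R1 x y = R1' x y) :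
    levelAux R1 R2 a m = levelAux R1' R2 a m := by
  cases m with
  | zero => rfl
  | succ k =>
    exact levelAux_succ_congr R2 a k fun x hx =>
      h x (Finset.disjoint_left.1 (disjoint_levelAux_succ R1 R2 a k) hx)

lemma level_succ_eq_empty {n : ℕ} (R1 R2 : Fin n → Fin n → Bool) (a : Fin n) (k : ℕ)
    (h : level R1 R2 a k = ∅) : level R1 R2 a (k + 1) = ∅ := by
  unfold level at h ⊢
  simp [levelAux, h]

lemma lt_card_levelUnion {n : ℕ} (R1 R2 : Fin n → Fin n → Bool) (a : Fin n) (k : ℕ)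
    (h : (level R1 R2 a k).Nonempty) : k < (levelUnion R1 R2 a k).card := by
  induction k with
  | zero => simp [levelUnion, levelAux]
  | succ k ih =>
    have hk : (level R1 R2 a k).Nonempty := by
      rw [Finset.nonempty_iff_ne_empty] at h ⊢
      exact fun h' => h (level_succ_eq_empty R1 R2 a k h')
    have hU : levelUnion R1 R2 a (k + 1) = levelUnion R1 R2 a k ∪ level R1 R2 a (k + 1) := rfl
    have hd : Disjoint (levelUnion R1 R2 a k) (level R1 R2 a (k + 1)) :=
      disjoint_levelAux_succ R1 R2 a k
    rw [hU, Finset.card_union_of_disjoint hd]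
    have := ih hk
    have := h.card_pos
    omega

lemma isProbabilityMeasure_bern {p : ℝ} (h0 : 0 ≤ p) (h1 : p ≤ 1) :
    IsProbabilityMeasure (bern p) := by
  constructor
  simp only [bern, Measure.add_apply, Measure.smul_apply, smul_eq_mul, measure_univ, mul_one]
  rw [← ENNReal.ofReal_add h0 (by linarith)]
  simp

lemma bern_true (p : ℝ) : bern p {true} = ENNReal.ofReal p := by
  simp [bern]

/-- Under a product of Bernoulli measures, the coins of `T` all succeed independently of any
event that does not depend on the coins of `T`. -/
lemma pi_bern_inter_forall_true {ι : Type*} [Fintype ι] [DecidableEq ι] {p : ℝ}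
    (h0 : 0 ≤ p) (h1 : p ≤ 1) (T : Finset ι) (E : Set (ι → Bool))
    (hE : ∀ ω ∈ E, ∀ ω', (∀ i ∉ T, ω i = ω' i) → ω' ∈ E) :
    (Measure.pi fun _ : ι => bern p) (E ∩ {ω | ∀ i ∈ T, ω i = true}) =
      (Measure.pi fun _ : ι => bern p) E * ENNReal.ofReal p ^ T.card := by
  have := isProbabilityMeasure_bern h0 h1
  have hindep : ProbabilityTheory.iIndepFun (fun (i : ι) (ω : ι → Bool) => ω i)
      (Measure.pi fun _ : ι => bern p) :=
    ProbabilityTheory.iIndepFun_pi (X := fun _ b => b) fun _ => aemeasurable_id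
  have hTT := hindep.indepFun_finset Tᶜ T disjoint_compl_left fun i => measurable_pi_apply i
  have hEpre : E = (fun (ω : ι → Bool) (i : (Tᶜ : Finset ι)) => ω i) ⁻¹'
      (Set.image (fun (ω : ι → Bool) (i : (Tᶜ : Finset ι)) => ω i) E) := by
    refine Set.Subset.antisymm (Set.subset_preimage_image _ _) ?_
    rintro ω' ⟨ω, hω, hωω'⟩
    exact hE ω hω ω' fun i hi => congrFun hωω' ⟨i, Finset.mem_compl.2 hi⟩
  have hTpre : {ω : ι → Bool | ∀ i ∈ T, ω i = true} =
      (fun (ω : ι → Bool) (i : T) => ω i) ⁻¹' {v | ∀ i, v i = true} := by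
    ext ω
    simp
  have hT : (Measure.pi fun _ : ι => bern p) {ω : ι → Bool | ∀ i ∈ T, ω i = true} =
      ENNReal.ofReal p ^ T.card := by
    have : {ω : ι → Bool | ∀ i ∈ T, ω i = true} =
        Set.univ.pi fun i => if i ∈ T then {true} else Set.univ := by
      ext ω
      simp only [Set.mem_ofPred_eq, Set.mem_univ_pi]
      refine forall_congr' fun i => ?_
      split_ifs with hi <;> simp [hi]
    rw [this, Measure.pi_pi]
    simp only [apply_ite (bern p), bern_true, measure_univ]
    simp
  rw [← hT]
  have key := hTT.measure_inter_preimage_eq_mul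
    (Set.image (fun (ω : ι → Bool) (i : (Tᶜ : Finset ι)) => ω i) E) {v | ∀ i, v i = true}
    (Set.toFinite _).measurableSet (Set.toFinite _).measurableSet
  rwa [← hEpre, ← hTpre] at key

/-- The size allowed for an `R₁`-level following a level of size `s`. -/
noncomputable def sizeBound (α : ℝ) (n s : ℕ) : ℝ :=
  (s : ℝ) * (n : ℝ) ^ (-(α / 2)) + (Real.logb 2 n) ^ 2

lemma sizeBound_nonneg (α : ℝ) (n s : ℕ) : 0 ≤ sizeBound α n s := by
  unfold sizeBound
  positivity

lemma eventually_choose_mul_pow_le {α : ℝ} (hα : 0 < α) :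
    ∀ᶠ n : ℕ in Filter.atTop, ∀ s : ℕ,
      ((s * n).choose (⌊sizeBound α n s⌋₊ + 1) : ℝ) *
        ((n : ℝ) ^ (-(1 + α))) ^ (⌊sizeBound α n s⌋₊ + 1) ≤ (n : ℝ) ^ (-3 : ℝ) := by
  have hcast : Filter.Tendsto (fun n : ℕ => (n : ℝ)) Filter.atTop Filter.atTop :=
    tendsto_natCast_atTop_atTop
  have hexp := ((tendsto_rpow_atTop (show 0 < α / 4 by positivity)).comp hcast).eventually_ge_atTop
    (Real.exp 1)
  have hlog := ((Filter.tendsto_pow_atTop (two_ne_zero)).comp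
    ((Real.tendsto_logb_atTop one_lt_two).comp hcast)).eventually_ge_atTop (12 / α)
  filter_upwards [hexp, hlog, Filter.eventually_ge_atTop 1] with n hexp hlog hn s
  simp only [Function.comp_apply] at hexp hlog
  set K := ⌊sizeBound α n s⌋₊ + 1 with hK
  have hn1 : (1 : ℝ) ≤ n := by exact_mod_cast hn
  have hn0 : (0 : ℝ) < n := by linarith
  have hBK : sizeBound α n s ≤ K := by
    rw [hK]
    push_cast
    exact (Nat.lt_floor_add_one _).le
  have hsK : (s : ℝ) * (n : ℝ) ^ (-(α / 2)) ≤ K := by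
    refine le_trans ?_ hBK
    unfold sizeBound
    nlinarith [sq_nonneg (Real.logb 2 n)]
  have hKlog : 12 / α ≤ K := by
    refine hlog.trans (le_trans ?_ hBK)
    unfold sizeBound
    have : 0 ≤ (s : ℝ) * (n : ℝ) ^ (-(α / 2)) := by positivity
    linarith
  have hmean : (s : ℝ) * n * (n : ℝ) ^ (-(1 + α)) ≤ K * (n : ℝ) ^ (-(α / 2)) := by
    have h1 : (n : ℝ) * (n : ℝ) ^ (-(1 + α)) = (n : ℝ) ^ (-(α / 2)) * (n : ℝ) ^ (-(α / 2)) := by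
      rw [← Real.rpow_add hn0]
      nth_rewrite 1 [← Real.rpow_one (n : ℝ)]
      rw [← Real.rpow_add hn0]
      congr 1
      ring
    rw [mul_assoc, h1, ← mul_assoc]
    gcongr
  have hexp' : Real.exp 1 * (n : ℝ) ^ (-(α / 2)) ≤ (n : ℝ) ^ (-(α / 4)) := by
    have h1 : (n : ℝ) ^ (-(α / 4)) = (n : ℝ) ^ (α / 4) * (n : ℝ) ^ (-(α / 2)) := by
      rw [← Real.rpow_add hn0]
      congr 1
      ring
    rw [h1]
    gcongr
  calc ((s * n).choose K : ℝ) * ((n : ℝ) ^ (-(1 + α))) ^ K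
      ≤ ((s * n : ℕ) : ℝ) ^ K / (K.factorial : ℝ) * ((n : ℝ) ^ (-(1 + α))) ^ K := by
        gcongr
        exact Nat.choose_le_pow_div K (s * n)
    _ = ((s : ℝ) * n * (n : ℝ) ^ (-(1 + α))) ^ K / (K.factorial : ℝ) := by
        push_cast
        ring
    _ ≤ (K * (n : ℝ) ^ (-(α / 2))) ^ K / (K.factorial : ℝ) := by
        gcongr
    _ = (K : ℝ) ^ K / (K.factorial : ℝ) * ((n : ℝ) ^ (-(α / 2))) ^ K := by
        ring
    _ ≤ Real.exp K * ((n : ℝ) ^ (-(α / 2))) ^ K := by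
        gcongr
        exact Real.pow_div_factorial_le_exp _ (by positivity) _
    _ = (Real.exp 1 * (n : ℝ) ^ (-(α / 2))) ^ K := by
        rw [mul_pow, ← Real.exp_nat_mul, mul_one]
    _ ≤ ((n : ℝ) ^ (-(α / 4))) ^ K := by
        gcongr
    _ = (n : ℝ) ^ (-(α / 4) * K) := by
        rw [Real.rpow_mul hn0.le, Real.rpow_natCast]
    _ ≤ (n : ℝ) ^ (-3 : ℝ) := by
        apply Real.rpow_le_rpow_of_exponent_le hn1
        rw [div_le_iff₀ hα] at hKlog
        nlinarith

/-- For a fixed `R₂`, root `a` and stage `m`, few outcomes of the `R₁`-coins let the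
`R₁`-neighbourhood of `S_m` exceed its size bound. -/
lemma pi_bern_oversized_le {n : ℕ} {α p ε : ℝ} (h0 : 0 ≤ p) (h1 : p ≤ 1)
    (hε : ∀ s : ℕ, ((s * n).choose (⌊sizeBound α n s⌋₊ + 1) : ℝ) *
      p ^ (⌊sizeBound α n s⌋₊ + 1) ≤ ε)
    (ω₂ : Fin n × Fin n → Bool) (a : Fin n) (m : ℕ) :
    (Measure.pi fun _ : Fin n × Fin n => bern p)
      {ω₁ | sizeBound α n (level (Rone (ω₁, ω₂)) (Rtwo (ω₁, ω₂)) a m).card <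
        ((Finset.univ.filter fun b =>
          ∃ a' ∈ level (Rone (ω₁, ω₂)) (Rtwo (ω₁, ω₂)) a m, ω₁ (a', b) = true).card : ℝ)}
      ≤ ENNReal.ofReal ε := by
  have := isProbabilityMeasure_bern h0 h1
  set μ := Measure.pi fun _ : Fin n × Fin n => bern p with hμ
  let L : (Fin n × Fin n → Bool) → Finset (Fin n) × Finset (Fin n) := fun ω₁ =>
    levelAux (Rone (ω₁, ω₂)) (Rtwo (ω₁, ω₂)) a m
  let K : ℕ → ℕ := fun s => ⌊sizeBound α n s⌋₊ + 1
  let 𝒯 : Finset (Fin n) → Finset (Finset (Fin n × Fin n)) := fun S =>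
    Finset.powersetCard (K S.card) (S ×ˢ Finset.univ)
  have hcover : {ω₁ | sizeBound α n (level (Rone (ω₁, ω₂)) (Rtwo (ω₁, ω₂)) a m).card <
        ((Finset.univ.filter fun b =>
          ∃ a' ∈ level (Rone (ω₁, ω₂)) (Rtwo (ω₁, ω₂)) a m, ω₁ (a', b) = true).card : ℝ)} ⊆
      ⋃ q ∈ (Finset.univ : Finset (Finset (Fin n) × Finset (Fin n))), ⋃ T ∈ 𝒯 q.1,
        (L ⁻¹' {q} ∩ {ω₁ | ∀ i ∈ T, ω₁ i = true}) := by
    intro ω₁ hω₁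
    simp only [Set.mem_ofPred_eq] at hω₁
    set S := level (Rone (ω₁, ω₂)) (Rtwo (ω₁, ω₂)) a m with hS
    have hcard : K S.card ≤ ((S ×ˢ Finset.univ).filter fun i => ω₁ i = true).card := by
      have h2 : K S.card ≤
          (Finset.univ.filter fun b => ∃ a' ∈ S, ω₁ (a', b) = true).card :=
        Nat.succ_le_of_lt ((Nat.floor_lt (sizeBound_nonneg _ _ _)).2 hω₁)
      refine h2.trans ((Finset.card_le_card ?_).trans
        (Finset.card_image_le (f := Prod.snd)))
      intro b hb
      obtain ⟨a', ha', hb'⟩ := (Finset.mem_filter.1 hb).2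
      exact Finset.mem_image.2 ⟨(a', b), by simp [ha', hb'], rfl⟩
    obtain ⟨T, hT, hTcard⟩ := Finset.exists_subset_card_eq hcard
    simp only [Set.mem_iUnion]
    refine ⟨L ω₁, Finset.mem_univ _, T, ?_, rfl, fun i hi => (Finset.mem_filter.1 (hT hi)).2⟩
    exact Finset.mem_powersetCard.2 ⟨hT.trans (Finset.filter_subset _ _), hTcard⟩
  have hinter : ∀ q, ∀ T ∈ 𝒯 q.1, μ (L ⁻¹' {q} ∩ {ω₁ | ∀ i ∈ T, ω₁ i = true}) =
      μ (L ⁻¹' {q}) * ENNReal.ofReal p ^ K q.1.card := by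
    intro q T hT
    obtain ⟨hTsub, hTcard⟩ := Finset.mem_powersetCard.1 hT
    rw [← hTcard]
    refine pi_bern_inter_forall_true h0 h1 T _ fun ω hω ω' hag => ?_
    rw [Set.mem_preimage, Set.mem_singleton_iff] at hω ⊢
    rw [← hω]
    refine (levelAux_congr (Rtwo (ω, ω₂)) a m fun x hx y => ?_).symm
    have hxy : (x, y) ∉ T := fun hxT => by
      have hxq := (Finset.mem_product.1 (hTsub hxT)).1
      rw [← hω] at hxq
      exact hx hxq
    simp only [Rone, hag _ hxy]
  calc _ ≤ ∑ q, ∑ T ∈ 𝒯 q.1, μ (L ⁻¹' {q} ∩ {ω₁ | ∀ i ∈ T, ω₁ i = true}) :=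
        (measure_mono hcover).trans ((measure_biUnion_finset_le _ _).trans
          (Finset.sum_le_sum fun q _ => measure_biUnion_finset_le _ _))
    _ = ∑ q, (((q.1.card * n).choose (K q.1.card) : ℕ) : ENNReal) *
          (μ (L ⁻¹' {q}) * ENNReal.ofReal p ^ K q.1.card) := by
        refine Finset.sum_congr rfl fun q _ => ?_
        rw [Finset.sum_congr rfl (hinter q), Finset.sum_const, nsmul_eq_mul]
        simp [𝒯]
    _ ≤ ∑ q, ENNReal.ofReal ε * μ (L ⁻¹' {q}) := by
        refine Finset.sum_le_sum fun q _ => ?_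
        have hq : (((q.1.card * n).choose (K q.1.card) : ℕ) : ENNReal) *
            ENNReal.ofReal p ^ K q.1.card ≤ ENNReal.ofReal ε := by
          rw [← ENNReal.ofReal_natCast, ← ENNReal.ofReal_pow h0,
            ← ENNReal.ofReal_mul (by positivity)]
          exact ENNReal.ofReal_le_ofReal (hε _)
        rw [mul_left_comm, mul_comm]
        gcongr
    _ = ENNReal.ofReal ε := by
        rw [← Finset.mul_sum, sum_measure_preimage_singleton _
          fun q _ => (Set.toFinite _).measurableSet]
        simp

/-- The event that more vertices than `sizeBound` allows receive an `R₁`-coin from `S_m`. -/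
def oversized (α : ℝ) {n : ℕ} (a : Fin n) (m : ℕ) : Set (Omega n) :=
  {ω | sizeBound α n (level (Rone ω) (Rtwo ω) a m).card <
    ((Finset.univ.filter fun b =>
      ∃ a' ∈ level (Rone ω) (Rtwo ω) a m, ω.1 (a', b) = true).card : ℝ)}

/-- Away from the oversized events, every level defined via `R₁` satisfies its size bound. -/
lemma card_level_succ_le {n : ℕ} {α : ℝ} {ω : Omega n}
    (hω : ω ∉ ⋃ a : Fin n, ⋃ m ∈ Finset.range n, oversized α a m) (a : Fin n) (m : ℕ)
    (hm : m < heightAt (Rone ω) (Rtwo ω) a)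
    (hR : ∃ a' ∈ level (Rone ω) (Rtwo ω) a m, ∃ b : Fin n,
      b ∉ levelUnion (Rone ω) (Rtwo ω) a m ∧ Rone ω a' b = true) :
    ((level (Rone ω) (Rtwo ω) a (m + 1)).card : ℝ) ≤
      sizeBound α n (level (Rone ω) (Rtwo ω) a m).card := by
  have hmn : m < n := by
    have hne : (level (Rone ω) (Rtwo ω) a (m + 1)).Nonempty :=
      Finset.nonempty_iff_ne_empty.2 (Nat.notMem_of_lt_sInf hm)
    have h1 := lt_card_levelUnion _ _ a (m + 1) hne
    have h2 := (levelUnion (Rone ω) (Rtwo ω) a (m + 1)).card_le_univ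
    rw [Fintype.card_fin] at h2
    omega
  simp only [Set.mem_iUnion, not_exists] at hω
  have hsmall := hω a m (Finset.mem_range.2 hmn)
  rw [oversized, Set.mem_ofPred_eq, not_lt] at hsmall
  refine le_trans ?_ hsmall
  norm_cast
  refine Finset.card_le_card fun b hb => ?_
  have hN : (Finset.univ.filter fun b => b ∉ (levelAux (Rone ω) (Rtwo ω) a m).2 ∧
      ∃ a' ∈ (levelAux (Rone ω) (Rtwo ω) a m).1, Rone ω a' b = true).Nonempty := by
    obtain ⟨a', ha', b, hb, hab⟩ := hR
    exact ⟨b, Finset.mem_filter.2 ⟨Finset.mem_univ _, hb, a', ha', hab⟩⟩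
  simp only [level, levelAux, if_pos hN] at hb
  obtain ⟨-, -, a', ha', hab⟩ := Finset.mem_filter.1 hb
  refine Finset.mem_filter.2 ⟨Finset.mem_univ _, a', ha', ?_⟩
  unfold Rone at hab
  split_ifs at hab
  exact hab

lemma rpow_neg_le_one {n : ℕ} (hn : 1 ≤ n) {x : ℝ} (hx : 0 ≤ x) : (n : ℝ) ^ (-x) ≤ 1 :=
  Real.rpow_le_one_of_one_le_of_nonpos (by exact_mod_cast hn) (by linarith)

lemma isProbabilityMeasure_digraphMeasure {α₁ α₂ : ℝ} (h1 : 0 ≤ 1 + α₁) (h2 : 0 ≤ 1 - α₂)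
    {n : ℕ} (hn : 1 ≤ n) : IsProbabilityMeasure (digraphMeasure α₁ α₂ n) := by
  have := isProbabilityMeasure_bern (by positivity) (rpow_neg_le_one hn h1)
  have := isProbabilityMeasure_bern (by positivity) (rpow_neg_le_one hn h2)
  unfold digraphMeasure
  infer_instance

lemma digraphMeasure_iUnion_oversized_le {α₁ α₂ : ℝ} (h1 : 0 ≤ 1 + α₁) (h2 : 0 ≤ 1 - α₂)
    {n : ℕ} (hn : 1 ≤ n)
    (hε : ∀ s : ℕ, ((s * n).choose (⌊sizeBound α₁ n s⌋₊ + 1) : ℝ) *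
      ((n : ℝ) ^ (-(1 + α₁))) ^ (⌊sizeBound α₁ n s⌋₊ + 1) ≤ (n : ℝ) ^ (-3 : ℝ)) :
    digraphMeasure α₁ α₂ n (⋃ a : Fin n, ⋃ m ∈ Finset.range n, oversized α₁ a m) ≤
      ENNReal.ofReal ((n : ℝ)⁻¹) := by
  have hstage : ∀ (a : Fin n) (m : ℕ), digraphMeasure α₁ α₂ n (oversized α₁ a m) ≤
      ENNReal.ofReal ((n : ℝ) ^ (-3 : ℝ)) := by
    intro a m
    have := isProbabilityMeasure_bern (by positivity) (rpow_neg_le_one hn h2)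
    rw [digraphMeasure, Measure.prod_apply_symm (Set.toFinite _).measurableSet]
    refine (lintegral_mono fun ω₂ => pi_bern_oversized_le (by positivity)
      (rpow_neg_le_one hn h1) hε ω₂ a m).trans ?_
    rw [lintegral_const, measure_univ, mul_one]
  have hn0 : (0 : ℝ) < n := by exact_mod_cast hn
  calc _ ≤ ∑ a : Fin n, ∑ m ∈ Finset.range n, digraphMeasure α₁ α₂ n (oversized α₁ a m) :=
        (measure_iUnion_fintype_le _ _).trans
          (Finset.sum_le_sum fun a _ => measure_biUnion_finset_le _ _)
    _ ≤ ∑ _a : Fin n, ∑ _m ∈ Finset.range n, ENNReal.ofReal ((n : ℝ) ^ (-3 : ℝ)) :=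
        Finset.sum_le_sum fun a _ => Finset.sum_le_sum fun m _ => hstage a m
    _ = ENNReal.ofReal ((n : ℝ) * ((n : ℝ) * (n : ℝ) ^ (-3 : ℝ))) := by
        rw [ENNReal.ofReal_mul hn0.le, ENNReal.ofReal_mul hn0.le]
        simp
    _ = ENNReal.ofReal ((n : ℝ)⁻¹) := by
        congr 1
        rw [show (-3 : ℝ) = ((-3 : ℤ) : ℝ) by norm_num, Real.rpow_intCast]
        field_simp

/-- With high probability, in `G_{n,ᾱ}`: for every vertex `a` and every stage
`m < height(a,G)`, if `S_{G,a,m+1}` is defined via `ι = 1` (some `R₁`-edge leads from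
`S_{G,a,m}` outside `S_{G,a,0} ∪ ⋯ ∪ S_{G,a,m}`), then
`|S_{G,a,m+1}| ≤ |S_{G,a,m}| · n^{-α₁/2} + (log₂ n)²`. -/
theorem statement5 (α₁ α₂ : ℝ) (h0 : 0 < α₁) (h12 : α₁ < α₂) (h2 : α₂ < 1/4) :
    Filter.Tendsto
      (fun n : ℕ => digraphMeasure α₁ α₂ n
        {ω : Omega n | ∀ a : Fin n, ∀ m < heightAt (Rone ω) (Rtwo ω) a,
          (∃ a' ∈ level (Rone ω) (Rtwo ω) a m, ∃ b : Fin n,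
              b ∉ levelUnion (Rone ω) (Rtwo ω) a m ∧ Rone ω a' b = true) →
          ((level (Rone ω) (Rtwo ω) a (m + 1)).card : ℝ)
            ≤ ((level (Rone ω) (Rtwo ω) a m).card : ℝ) * (n : ℝ) ^ (-(α₁ / 2))
              + (Real.logb 2 n) ^ 2})
      Filter.atTop (nhds 1) := by
  have hlower : Filter.Tendsto (fun n : ℕ => 1 - ENNReal.ofReal ((n : ℝ)⁻¹))
      Filter.atTop (nhds 1) := by
    have h := ENNReal.Tendsto.sub (tendsto_const_nhds (x := (1 : ENNReal)))
      (ENNReal.tendsto_ofReal (tendsto_inv_atTop_nhds_zero_nat (𝕜 := ℝ)))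
      (Or.inl ENNReal.one_ne_top)
    simpa using h
  have h1 : 0 ≤ 1 + α₁ := by linarith
  have h3 : 0 ≤ 1 - α₂ := by linarith
  refine tendsto_of_tendsto_of_tendsto_of_le_of_le' hlower tendsto_const_nhds ?_ ?_
  · filter_upwards [eventually_choose_mul_pow_le h0, Filter.eventually_ge_atTop 1] with n hε hn
    have := isProbabilityMeasure_digraphMeasure h1 h3 hn
    calc 1 - ENNReal.ofReal ((n : ℝ)⁻¹)
        ≤ 1 - digraphMeasure α₁ α₂ n (⋃ a : Fin n, ⋃ m ∈ Finset.range n, oversized α₁ a m) :=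
          tsub_le_tsub_left (digraphMeasure_iUnion_oversized_le h1 h3 hn hε) 1
      _ = digraphMeasure α₁ α₂ n
            (⋃ a : Fin n, ⋃ m ∈ Finset.range n, oversized α₁ a m)ᶜ :=
          (prob_compl_eq_one_sub (Set.toFinite _).measurableSet).symm
      _ ≤ _ := measure_mono fun ω hω => card_level_succ_le hω
  · filter_upwards [Filter.eventually_ge_atTop 1] with n hn
    have := isProbabilityMeasure_digraphMeasure h1 h3 hn
    exact prob_le_one
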